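/- arXiv:quant-ph/0502055 — 7 statements merged into one kernel-verified Lean document; each statement's English description precedes it below -/
import Mathlib

section
/- Let n ≥ 1 and let v, w ∈ ℂⁿ be unit vectors, and set t = ‖⟨v, w⟩‖. Then the von Neumann entropy (in bits) of the matrix ρ = ½(|v⟩⟨v| + |w⟩⟨w|) equals the binary entropy H₂((1+t)/2); i.e. S(½(|v⟩⟨v| + |w⟩⟨w|)) = H₂((1+t)/2). -/
/-- The ℓ² inner product on complex-valued functions. -/
noncomputable def innerC {α : Type*} [Fintype α] (v w : α → ℂ) : ℂ :=
  ∑ i, star (v i) * w i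

/-- The outer product `|v⟩⟨v|`. -/
noncomputable def outer {α : Type*} (v : α → ℂ) : Matrix α α ℂ :=
  Matrix.of fun i j => v i * star (v j)

/-- Von Neumann entropy (in bits) of a Hermitian matrix, via its eigenvalues. -/
noncomputable def vnEntropy {m : Type*} [Fintype m] [DecidableEq m]
    {ρ : Matrix m m ℂ} (hρ : ρ.IsHermitian) : ℝ :=
  -∑ i, hρ.eigenvalues i * Real.logb 2 (hρ.eigenvalues i)

/-- Base-2 binary entropy, with the convention `0 · log 0 = 0`. -/
noncomputable def binEnt (p : ℝ) : ℝ :=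
  -(p * Real.logb 2 p) - (1 - p) * Real.logb 2 (1 - p)

open Polynomial in
/-- The eigenvalues of a Hermitian product `A * B` agree with the roots of the characteristic
polynomial of `B * A` up to zeros, so sums of a function vanishing at `0` agree. -/
theorem Matrix.IsHermitian.sum_eigenvalues_mul_comm {m k : Type*} [Fintype m] [DecidableEq m]
    [Fintype k] [DecidableEq k] {A : Matrix m k ℂ} {B : Matrix k m ℂ}
    (h : (A * B).IsHermitian) (f : ℝ → ℝ) (hf : f 0 = 0) :
    ∑ i, f (h.eigenvalues i) = ((B * A).charpoly.roots.map fun z => f z.re).sum := by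
  have key := congrArg (fun p : ℂ[X] => (p.roots.map fun z => f z.re).sum)
    (Matrix.charpoly_mul_comm' A B)
  have hX (l : ℕ) {M : ℂ[X]} (hM : M.Monic) : (X ^ l * M).roots = l • {0} + M.roots := by
    rw [roots_mul ((monic_X_pow l).mul hM).ne_zero, roots_X_pow]
  simpa [hX _ (Matrix.charpoly_monic _), h.roots_charpoly_eq_eigenvalues, hf,
    Multiset.map_nsmul, Multiset.sum_nsmul] using key

open Polynomial in
/-- The roots of the characteristic polynomial of half the Gram matrix of two unit vectors. -/
theorem roots_charpoly_half_gram (c : ℂ) :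
    (!![1 / 2, c / 2; star c / 2, 1 / 2] : Matrix (Fin 2) (Fin 2) ℂ).charpoly.roots =
      {(((1 + ‖c‖) / 2 : ℝ) : ℂ), ((1 - (1 + ‖c‖) / 2 : ℝ) : ℂ)} := by
  have hc : c * star c = (‖c‖ : ℂ) ^ 2 := by
    simpa using Complex.mul_conj' c
  have hfac : (!![1 / 2, c / 2; star c / 2, 1 / 2] : Matrix (Fin 2) (Fin 2) ℂ).charpoly =
      (X - C (((1 + ‖c‖) / 2 : ℝ) : ℂ)) * (X - C ((1 - (1 + ‖c‖) / 2 : ℝ) : ℂ)) := by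
    have htr : (1 / 2 + 1 / 2 : ℂ) =
        (((1 + ‖c‖) / 2 : ℝ) : ℂ) + ((1 - (1 + ‖c‖) / 2 : ℝ) : ℂ) := by
      push_cast; ring
    have hdet : (1 / 2 * (1 / 2) - c / 2 * (star c / 2) : ℂ) =
        (((1 + ‖c‖) / 2 : ℝ) : ℂ) * ((1 - (1 + ‖c‖) / 2 : ℝ) : ℂ) := by
      push_cast; linear_combination (-1 / 4 : ℂ) * hc
    rw [Matrix.charpoly_fin_two, Matrix.trace_fin_two_of, Matrix.det_fin_two_of, htr, hdet,
      C_add, C_mul]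
    ring
  rw [hfac, roots_mul (mul_ne_zero (X_sub_C_ne_zero _) (X_sub_C_ne_zero _)), roots_X_sub_C,
    roots_X_sub_C]
  rfl

theorem star_innerC {α : Type*} [Fintype α] (v w : α → ℂ) : star (innerC v w) = innerC w v := by
  simp [innerC, mul_comm]

/-- For unit vectors `v, w ∈ ℂⁿ` with `t = ‖⟨v,w⟩‖`, the von Neumann entropy of
`½(|v⟩⟨v| + |w⟩⟨w|)` equals `H₂((1+t)/2)`. -/
theorem entropy_of_mixture_of_two_pure_states
    (n : ℕ) (hn : 1 ≤ n) (v w : Fin n → ℂ)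
    (hv : innerC v v = 1) (hw : innerC w w = 1)
    (ρ : Matrix (Fin n) (Fin n) ℂ)
    (hρdef : ρ = (1/2 : ℂ) • (outer v + outer w))
    (hρ : ρ.IsHermitian) :
    vnEntropy hρ = binEnt ((1 + ‖innerC v w‖) / 2) := by
  let A : Matrix (Fin n) (Fin 2) ℂ := Matrix.of fun i => ![v i, w i]
  let B : Matrix (Fin 2) (Fin n) ℂ := (1 / 2 : ℂ) • A.conjTranspose
  have hAB : ρ = A * B := by
    subst hρdef
    ext i j
    simp [A, B, outer, Matrix.mul_apply, Fin.sum_univ_two]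
    ring
  have hentry (x y : Fin n → ℂ) : ∑ i, 1 / 2 * star (x i) * y i = innerC x y / 2 := by
    rw [innerC, Finset.sum_div]
    exact Finset.sum_congr rfl fun i _ => by ring
  have hBA : B * A = !![1 / 2, innerC v w / 2; star (innerC v w) / 2, 1 / 2] := by
    ext i j
    rw [star_innerC]
    fin_cases i <;> fin_cases j
    · simpa [A, B, Matrix.mul_apply, hv] using hentry v v
    · simpa [A, B, Matrix.mul_apply] using hentry v w
    · simpa [A, B, Matrix.mul_apply] using hentry w v
    · simpa [A, B, Matrix.mul_apply, hw] using hentry w w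
  subst hAB
  rw [vnEntropy, hρ.sum_eigenvalues_mul_comm (fun x => x * Real.logb 2 x) (by simp), hBA,
    roots_charpoly_half_gram, binEnt]
  simp only [Multiset.insert_eq_cons, Multiset.map_cons, Multiset.map_singleton,
    Multiset.sum_cons, Multiset.sum_singleton, Complex.ofReal_re]
  ring
end

section
/- For every real x with 0 ≤ x ≤ 1, one has 1 − x² ≤ H₂((1−x)/2) ≤ 1 − x²/2. -/
/-- The gap, in nats, between the binary entropy of `(1 - x) / 2` and its maximal value. -/
noncomputable def entropyGap (x : ℝ) : ℝ := Real.log 2 - Real.binEntropy ((1 - x) / 2)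

lemma continuous_entropyGap : Continuous entropyGap := by
  unfold entropyGap
  fun_prop

lemma entropyGap_zero : entropyGap 0 = 0 := by
  simp [entropyGap]

lemma entropyGap_one : entropyGap 1 = Real.log 2 := by
  simp [entropyGap]

lemma hasDerivAt_entropyGap {x : ℝ} (hx0 : -1 < x) (hx1 : x < 1) :
    HasDerivAt entropyGap (1 / 2 * Real.log ((1 + x) / (1 - x))) x := by
  have hp : HasDerivAt (fun y : ℝ => (1 - y) / 2) (-1 / 2) x :=
    ((hasDerivAt_id x).const_sub 1).div_const 2
  have hH := Real.hasDerivAt_binEntropy (p := (1 - x) / 2) (by linarith) (by linarith)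
  refine ((hH.comp x hp).const_sub (Real.log 2)).congr_deriv ?_
  rw [show 1 - (1 - x) / 2 = (1 + x) / 2 by ring, Real.log_div (by linarith) two_ne_zero,
    Real.log_div (by linarith) two_ne_zero, Real.log_div (by linarith) (by linarith)]
  ring

lemma half_sq_le_entropyGap {x : ℝ} (hx0 : 0 ≤ x) (hx1 : x ≤ 1) :
    x ^ 2 / 2 ≤ entropyGap x := by
  have hmono : MonotoneOn (fun y => entropyGap y - y ^ 2 / 2) (Set.Icc 0 1) := by
    refine monotoneOn_of_hasDerivWithinAt_nonneg
      (f' := fun y => 1 / 2 * Real.log ((1 + y) / (1 - y)) - y) (convex_Icc 0 1)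
      (continuous_entropyGap.sub (by fun_prop)).continuousOn ?_ ?_ <;>
      rw [interior_Icc] <;> rintro y ⟨hy0, hy1⟩
    · refine HasDerivAt.hasDerivWithinAt <|
        ((hasDerivAt_entropyGap (by linarith) hy1).sub
          ((hasDerivAt_pow 2 y).div_const 2)).congr_deriv ?_
      norm_num
    · simpa using Real.sum_range_le_log_div hy0.le hy1 1
  have h := hmono ⟨le_rfl, zero_le_one⟩ ⟨hx0, hx1⟩ hx0
  norm_num [entropyGap_zero] at h
  exact h

lemma two_mul_entropyGap_le {x : ℝ} (hx0 : 0 ≤ x) (hx1 : x < 1) :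
    2 * entropyGap x ≤ x * (1 / 2 * Real.log ((1 + x) / (1 - x))) := by
  let F (y : ℝ) : ℝ := y * (1 / 2 * Real.log ((1 + y) / (1 - y))) - 2 * entropyGap y
  have hF : ∀ y ∈ Set.Icc 0 x,
      HasDerivAt F (y / (1 - y ^ 2) - 1 / 2 * Real.log ((1 + y) / (1 - y))) y := by
    rintro y ⟨hy0, hyx⟩
    have hlog := Real.hasDerivAt_half_log_one_add_div_one_sub_sub_sum_range (y := y) 0
      (by linarith) (by linarith)
    simp only [Finset.range_zero, Finset.sum_empty, sub_zero, pow_zero] at hlog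
    refine (((hasDerivAt_id y).mul hlog).sub
      ((hasDerivAt_entropyGap (by linarith) (by linarith)).const_mul 2)).congr_deriv ?_
    simp only [id]
    ring
  have hmono : MonotoneOn F (Set.Icc 0 x) := by
    refine monotoneOn_of_hasDerivWithinAt_nonneg (convex_Icc 0 x)
      (fun y hy => (hF y hy).continuousAt.continuousWithinAt)
      (fun y hy => (hF y (interior_subset hy)).hasDerivWithinAt) fun y hy => ?_
    obtain ⟨hy0, hyx⟩ := interior_subset hy
    simpa using Real.log_div_le_sum_range_add hy0 (hyx.trans_lt hx1) 0
  have h := hmono ⟨le_rfl, hx0⟩ ⟨hx0, le_rfl⟩ hx0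
  simpa [F, entropyGap_zero] using h

lemma monotoneOn_entropyGap_div_sq :
    MonotoneOn (fun x => entropyGap x / x ^ 2) (Set.Ioc 0 1) := by
  refine monotoneOn_of_hasDerivWithinAt_nonneg
    (f' := fun y => (1 / 2 * Real.log ((1 + y) / (1 - y)) * y ^ 2 - entropyGap y * (2 * y)) /
      (y ^ 2) ^ 2) (convex_Ioc 0 1)
    (continuous_entropyGap.continuousOn.div (by fun_prop) fun y hy => pow_ne_zero 2 hy.1.ne')
    ?_ ?_ <;>
    rw [interior_Ioc] <;> rintro y ⟨hy0, hy1⟩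
  · refine HasDerivAt.hasDerivWithinAt <|
      ((hasDerivAt_entropyGap (by linarith) hy1).div (hasDerivAt_pow 2 y)
        (pow_ne_zero 2 hy0.ne')).congr_deriv ?_
    norm_num
  · have h := mul_le_mul_of_nonneg_left (two_mul_entropyGap_le hy0.le hy1) hy0.le
    exact div_nonneg (by linarith) (by positivity)

lemma entropyGap_le_sq_mul_log_two {x : ℝ} (hx0 : 0 ≤ x) (hx1 : x ≤ 1) :
    entropyGap x ≤ x ^ 2 * Real.log 2 := by
  rcases hx0.eq_or_lt with rfl | hx
  · simp [entropyGap_zero]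
  have h := monotoneOn_entropyGap_div_sq ⟨hx, hx1⟩ ⟨one_pos, le_rfl⟩ hx1
  simp only [entropyGap_one, one_pow, div_one] at h
  rwa [div_le_iff₀ (by positivity), mul_comm] at h

lemma binEnt_eq_one_sub_entropyGap_div (x : ℝ) :
    binEnt ((1 - x) / 2) = 1 - entropyGap x / Real.log 2 := by
  have h2 : Real.log 2 ≠ 0 := (Real.log_pos one_lt_two).ne'
  simp only [binEnt, entropyGap, Real.binEntropy, Real.logb, Real.log_inv]
  field_simp
  ring

/-- For `0 ≤ x ≤ 1`, `1 − x² ≤ H₂((1−x)/2) ≤ 1 − x²/2`. -/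
theorem binEnt_quadratic_bounds (x : ℝ) (hx0 : 0 ≤ x) (hx1 : x ≤ 1) :
    1 - x ^ 2 ≤ binEnt ((1 - x) / 2) ∧ binEnt ((1 - x) / 2) ≤ 1 - x ^ 2 / 2 := by
  have h2 : 0 < Real.log 2 := Real.log_pos one_lt_two
  rw [binEnt_eq_one_sub_entropyGap_div]
  constructor
  · exact sub_le_sub_left ((div_le_iff₀ h2).2 (entropyGap_le_sq_mul_log_two hx0 hx1)) 1
  · refine sub_le_sub_left ((le_div_iff₀ h2).2 ?_) 1
    have hlog : Real.log 2 ≤ 1 := by linarith [Real.log_le_sub_one_of_pos (zero_lt_two' ℝ)]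
    exact (mul_le_of_le_one_right (by positivity) hlog).trans (half_sq_le_entropyGap hx0 hx1)
end

section
/- Let ρ and σ be n×n density matrices and let μ = (ρ+σ)/2. Then the von Neumann entropy (in bits) of the density matrix τ = ½(ρ ⊗ₖ σ + σ ⊗ₖ ρ) on ℂⁿ⊗ℂⁿ satisfies S(τ) ≤ 2·S(μ). (Both marginals of τ equal μ, so this is an instance of subadditivity of von Neumann entropy.) -/
open Kronecker ComplexOrder

open Matrix Real

theorem vnEntropy_eq_sum_negMulLog_div {m : Type*} [Fintype m] [DecidableEq m]
    {A : Matrix m m ℂ} (hA : A.IsHermitian) :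
    vnEntropy hA = (∑ i, negMulLog (hA.eigenvalues i)) / log 2 := by
  simp only [vnEntropy, negMulLog, logb, Finset.sum_div, ← Finset.sum_neg_distrib]
  exact Finset.sum_congr rfl fun i _ => by ring

/-- The pointwise form of the Gibbs inequality, against a product reference weight `a * b`. -/
theorem negMulLog_le_add_mul_sub {q a b : ℝ} (hq : 0 ≤ q) (ha : 0 ≤ a) (hb : 0 ≤ b)
    (hqa : a = 0 → q = 0) (hqb : b = 0 → q = 0) :
    negMulLog q ≤ -(q * log a) - q * log b + a * b - q := by
  rcases hq.eq_or_lt with rfl | hq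
  · simpa using mul_nonneg ha hb
  have ha : 0 < a := ha.lt_of_ne fun h => hq.ne' (hqa h.symm)
  have hb : 0 < b := hb.lt_of_ne fun h => hq.ne' (hqb h.symm)
  have h := log_le_sub_one_of_pos (div_pos (mul_pos ha hb) hq)
  rw [log_div (by positivity) hq.ne', log_mul ha.ne' hb.ne'] at h
  have h' := mul_le_mul_of_nonneg_left h hq.le
  have hcancel : q * (a * b / q - 1) = a * b - q := by field_simp
  rw [hcancel] at h'
  rw [negMulLog]
  linarith

/-- Subadditivity of the Shannon entropy. -/
theorem sum_negMulLog_le_add_marginals {α β : Type*} [Fintype α] [Fintype β]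
    {q : α → β → ℝ} {a : α → ℝ} {b : β → ℝ} (hq : ∀ i j, 0 ≤ q i j)
    (ha : ∀ i, ∑ j, q i j = a i) (hb : ∀ j, ∑ i, q i j = b j) (hsum : ∑ i, a i = 1) :
    ∑ i, ∑ j, negMulLog (q i j) ≤ ∑ i, negMulLog (a i) + ∑ j, negMulLog (b j) := by
  have ha0 i : 0 ≤ a i := ha i ▸ Finset.sum_nonneg fun j _ => hq i j
  have hb0 j : 0 ≤ b j := hb j ▸ Finset.sum_nonneg fun i _ => hq i j
  have hbsum : ∑ j, b j = 1 := by
    simp_rw [← hb]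
    rw [Finset.sum_comm]
    simp_rw [ha, hsum]
  have hqa i j (h : a i = 0) : q i j = 0 :=
    (Finset.sum_eq_zero_iff_of_nonneg fun j _ => hq i j).1 ((ha i).trans h) j (Finset.mem_univ j)
  have hqb i j (h : b j = 0) : q i j = 0 :=
    (Finset.sum_eq_zero_iff_of_nonneg fun i _ => hq i j).1 ((hb j).trans h) i (Finset.mem_univ i)
  have hfst : ∑ i, ∑ j, q i j * log (a i) = ∑ i, a i * log (a i) := by
    simp_rw [← Finset.sum_mul, ha]
  have hsnd : ∑ i, ∑ j, q i j * log (b j) = ∑ j, b j * log (b j) := by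
    rw [Finset.sum_comm]
    simp_rw [← Finset.sum_mul, hb]
  have hprod : ∑ i, ∑ j, a i * b j = 1 := by
    simp_rw [← Finset.mul_sum, hbsum, mul_one, hsum]
  have htot : ∑ i, ∑ j, q i j = 1 := by simp_rw [ha, hsum]
  calc ∑ i, ∑ j, negMulLog (q i j)
      ≤ ∑ i, ∑ j, (-(q i j * log (a i)) - q i j * log (b j) + a i * b j - q i j) :=
        Finset.sum_le_sum fun i _ => Finset.sum_le_sum fun j _ =>
          negMulLog_le_add_mul_sub (hq i j) (ha0 i) (hb0 j) (hqa i j) (hqb i j)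
    _ = ∑ i, negMulLog (a i) + ∑ j, negMulLog (b j) := by
        simp only [Finset.sum_sub_distrib, Finset.sum_add_distrib, Finset.sum_neg_distrib,
          negMulLog, neg_mul, hfst, hsnd, hprod, htot]
        ring

/-- Applying a doubly stochastic matrix does not decrease the entropy of a nonnegative vector. -/
theorem sum_negMulLog_le_of_doublyStochastic {m : Type*} [Fintype m] {P : m → m → ℝ} {t : m → ℝ}
    (hP : ∀ i k, 0 ≤ P i k) (hrow : ∀ i, ∑ k, P i k = 1) (hcol : ∀ k, ∑ i, P i k = 1)
    (ht : ∀ k, 0 ≤ t k) :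
    ∑ k, negMulLog (t k) ≤ ∑ i, negMulLog (∑ k, P i k * t k) := by
  calc ∑ k, negMulLog (t k) = ∑ i, ∑ k, P i k * negMulLog (t k) := by
        rw [Finset.sum_comm]
        simp_rw [← Finset.sum_mul, hcol, one_mul]
    _ ≤ ∑ i, negMulLog (∑ k, P i k * t k) := Finset.sum_le_sum fun i _ => by
        simpa only [smul_eq_mul] using concaveOn_negMulLog.le_map_sum (fun k _ => hP i k) (hrow i)
          (fun k _ => Set.mem_Ici.2 (ht k))

theorem sum_normSq_row_of_mul_conjTranspose_eq_one {m : Type*} [Fintype m] [DecidableEq m]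
    {X : Matrix m m ℂ} (hX : X * Xᴴ = 1) (i : m) : ∑ k, Complex.normSq (X i k) = 1 := by
  have h := congrFun (congrFun hX i) i
  simp only [mul_apply, conjTranspose_apply, one_apply_eq, RCLike.star_def, Complex.mul_conj] at h
  exact_mod_cast h

/-- The entropy of the diagonal in any orthonormal basis bounds the entropy of the spectrum. -/
theorem sum_negMulLog_eigenvalues_le_diag {m : Type*} [Fintype m] [DecidableEq m]
    {A W : Matrix m m ℂ} (hA : A.IsHermitian) (hA0 : A.PosSemidef)
    (hW : W ∈ unitary (Matrix m m ℂ)) :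
    ∑ k, negMulLog (hA.eigenvalues k) ≤ ∑ i, negMulLog ((Wᴴ * A * W) i i).re := by
  obtain ⟨X, hXdef⟩ : ∃ X, X = Wᴴ * (hA.eigenvectorUnitary : Matrix m m ℂ) := ⟨_, rfl⟩
  have hX : X ∈ unitary (Matrix m m ℂ) :=
    hXdef ▸ mul_mem (Unitary.star_mem hW) hA.eigenvectorUnitary.2
  have hdiag i : ((Wᴴ * A * W) i i).re = ∑ k, Complex.normSq (X i k) * hA.eigenvalues k := by
    have hconj : Wᴴ * A * W = X * diagonal (RCLike.ofReal ∘ hA.eigenvalues) * Xᴴ := by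
      conv_lhs => rw [hA.spectral_theorem, Unitary.conjStarAlgAut_apply]
      simp [hXdef, conjTranspose_mul, Matrix.mul_assoc, star_eq_conjTranspose]
    rw [hconj, mul_apply, Complex.re_sum]
    refine Finset.sum_congr rfl fun k _ => ?_
    simp [mul_diagonal, Complex.normSq_apply]
    ring
  simp_rw [hdiag]
  refine sum_negMulLog_le_of_doublyStochastic (fun i k => Complex.normSq_nonneg _)
    (sum_normSq_row_of_mul_conjTranspose_eq_one (Unitary.mem_iff.1 hX).2) (fun k => ?_)
    hA0.eigenvalues_nonneg
  have hXH : Xᴴ * Xᴴᴴ = 1 := by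
    rw [conjTranspose_conjTranspose]
    exact (Unitary.mem_iff.1 hX).1
  simpa using sum_normSq_row_of_mul_conjTranspose_eq_one hXH k

/-- For density matrices `ρ, σ` with `μ = (ρ+σ)/2`, the symmetrized state
`τ = ½(ρ⊗σ + σ⊗ρ)` satisfies `S(τ) ≤ 2 S(μ)` (subadditivity: both marginals of
`τ` equal `μ`). -/
theorem entropy_symmetrized_le_two_entropy_average
    (n : ℕ) (ρ σ : Matrix (Fin n) (Fin n) ℂ)
    (hρ : ρ.PosSemidef) (hρ1 : ρ.trace = 1)
    (hσ : σ.PosSemidef) (hσ1 : σ.trace = 1)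
    (τ : Matrix (Fin n × Fin n) (Fin n × Fin n) ℂ)
    (hτdef : τ = (1/2 : ℂ) • (ρ ⊗ₖ σ + σ ⊗ₖ ρ))
    (hτ : τ.IsHermitian)
    (μ : Matrix (Fin n) (Fin n) ℂ)
    (hμdef : μ = (1/2 : ℂ) • (ρ + σ))
    (hμ : μ.IsHermitian) :
    vnEntropy hτ ≤ 2 * vnEntropy hμ := by
  obtain ⟨U, hUmem, hUμ⟩ : ∃ U ∈ unitary (Matrix (Fin n) (Fin n) ℂ),
      Uᴴ * μ * U = diagonal (RCLike.ofReal ∘ hμ.eigenvalues) := by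
    refine ⟨hμ.eigenvectorUnitary, hμ.eigenvectorUnitary.2, ?_⟩
    have h := hμ.conjStarAlgAut_star_eigenvectorUnitary
    rw [Unitary.conjStarAlgAut_apply] at h
    simpa [star_eq_conjTranspose] using h
  have hUU : U * Uᴴ = 1 := (Unitary.mem_iff.1 hUmem).2
  have hpsd : τ.PosSemidef := hτdef ▸
    ((hρ.kronecker hσ).add (hσ.kronecker hρ)).smul (one_div_nonneg.2 zero_le_two)
  have diag_nonneg {A : Matrix (Fin n) (Fin n) ℂ} (hA : A.PosSemidef) (i) :
      0 ≤ (Uᴴ * A * U) i i := (hA.conjTranspose_mul_mul_same U).diag_nonneg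
  have sum_diag {A : Matrix (Fin n) (Fin n) ℂ} (hA : A.trace = 1) :
      ∑ i, ((Uᴴ * A * U) i i).re = 1 := by
    have h : (Uᴴ * A * U).trace = 1 := by
      rw [trace_mul_comm, ← Matrix.mul_assoc, hUU, Matrix.one_mul, hA]
    simpa [trace] using congrArg Complex.re h
  set r : Fin n → ℝ := fun i => ((Uᴴ * ρ * U) i i).re with hr
  set s : Fin n → ℝ := fun i => ((Uᴴ * σ * U) i i).re with hs
  have hr0 i : 0 ≤ r i := (Complex.nonneg_iff.1 (diag_nonneg hρ i)).1
  have hs0 i : 0 ≤ s i := (Complex.nonneg_iff.1 (diag_nonneg hσ i)).1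
  have hr1 : ∑ i, r i = 1 := sum_diag hρ1
  have hs1 : ∑ i, s i = 1 := sum_diag hσ1
  have hm i : (r i + s i) / 2 = hμ.eigenvalues i := by
    have h := congrArg Complex.re (congrFun (congrFun hUμ i) i)
    rw [congrArg (Uᴴ * · * U) hμdef] at h
    simp [Matrix.mul_add, Matrix.add_mul] at h
    rw [← h]
    ring
  have hq (i j) : (((U ⊗ₖ U)ᴴ * τ * (U ⊗ₖ U)) (i, j) (i, j)).re = (r i * s j + s i * r j) / 2 := by
    have him {A : Matrix (Fin n) (Fin n) ℂ} (hA : A.PosSemidef) (i) :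
        ((Uᴴ * A * U) i i).im = 0 := (Complex.nonneg_iff.1 (diag_nonneg hA i)).2.symm
    rw [hτdef, conjTranspose_kronecker, Matrix.mul_smul, Matrix.smul_mul, Matrix.mul_add,
      Matrix.add_mul]
    simp only [← mul_kronecker_mul]
    simp [hr, hs, him hρ, him hσ]
    ring
  have hfst i : ∑ j, (r i * s j + s i * r j) / 2 = hμ.eigenvalues i := by
    rw [← Finset.sum_div, Finset.sum_add_distrib, ← Finset.mul_sum, ← Finset.mul_sum, hr1, hs1,
      ← hm]
    ring
  have hsnd j : ∑ i, (r i * s j + s i * r j) / 2 = hμ.eigenvalues j := by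
    rw [← Finset.sum_div, Finset.sum_add_distrib, ← Finset.sum_mul, ← Finset.sum_mul, hr1, hs1,
      ← hm]
    ring
  have hsum : ∑ i, hμ.eigenvalues i = 1 := by
    simp_rw [← hm]
    rw [← Finset.sum_div, Finset.sum_add_distrib, hr1, hs1]
    norm_num
  have hspec := (sum_negMulLog_eigenvalues_le_diag hτ hpsd
    (kronecker_mem_unitary hUmem hUmem)).trans_eq (Fintype.sum_prod_type _)
  simp_rw [hq] at hspec
  have hsub := sum_negMulLog_le_add_marginals (fun i j => div_nonneg (add_nonneg
    (mul_nonneg (hr0 i) (hs0 j)) (mul_nonneg (hs0 i) (hr0 j))) zero_le_two) hfst hsnd hsum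
  rw [vnEntropy_eq_sum_negMulLog_div, vnEntropy_eq_sum_negMulLog_div, ← mul_div_assoc]
  exact div_le_div_of_nonneg_right (by linarith) (log_nonneg one_le_two)
end

section
/- Let ρ and σ be 2×2 density matrices. Then the von Neumann entropy (in bits) of τ = ½(ρ ⊗ₖ σ + σ ⊗ₖ ρ) satisfies S(τ) + Tr(ρ·σ) ≤ 5/2, where Tr(ρ·σ) is interpreted as the real number it equals. Equivalently, S(τ) − 1 + Tr(ρ·σ) ≤ 3/2; this yields the sum-rate bound R₁+R₂ ≤ 3/2 for the unassisted two-user quantum binary adder channel. -/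
open Kronecker ComplexOrder

/-- Quadratic lower bound on `x * log x` for `x = u ^ 4` in `(0, 4]`. -/
theorem quadratic_le_pow_four_mul_log {u : ℝ} (hu : 0 < u) (hu4 : u ^ 4 ≤ 4) :
    u ^ 4 - 1 + Real.log 2 / 4 * (u ^ 4 - 1) ^ 2 ≤ u ^ 4 * Real.log (u ^ 4) := by
  have hlog : 4 * (1 - u⁻¹) ≤ Real.log (u ^ 4) := by
    rw [Real.log_pow]
    have := Real.one_sub_inv_le_log_of_pos hu
    push_cast
    linarith
  have hmul : 4 * u ^ 4 - 4 * u ^ 3 ≤ u ^ 4 * Real.log (u ^ 4) := by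
    calc 4 * u ^ 4 - 4 * u ^ 3 = u ^ 4 * (4 * (1 - u⁻¹)) := by field_simp
      _ ≤ _ := by gcongr
  have hv : u ^ 2 ≤ 2 := by nlinarith [sq_nonneg u]
  have hw : u ≤ 1.4143 := by nlinarith
  have hfactor : 0.1733 * ((u + 1) ^ 2 * (u ^ 2 + 1) ^ 2) ≤ 3 * u ^ 2 + 2 * u + 1 := by
    have h1 : (u ^ 2 + 1) ^ 2 ≤ 4 * u ^ 2 + 1 := by nlinarith [sq_nonneg u]
    have h2 : (u + 1) ^ 2 * (u ^ 2 + 1) ^ 2 ≤ (u + 1) ^ 2 * (4 * u ^ 2 + 1) := by gcongr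
    nlinarith [mul_nonneg hu.le (sub_nonneg.2 hv), mul_nonneg (sq_nonneg u) (sub_nonneg.2 hv),
      mul_nonneg hu.le (sub_nonneg.2 hw)]
  have hl : Real.log 2 / 4 * (u ^ 4 - 1) ^ 2 ≤ 0.1733 * (u ^ 4 - 1) ^ 2 := by
    gcongr
    linarith [Real.log_two_lt_d9]
  nlinarith [mul_nonneg (sq_nonneg (u - 1)) (sub_nonneg.2 hfactor)]

/-- Quadratic upper bound on `-l * log₂ l` for `l` in `[0, 1]`, tangent to it at `l = 1/4`. -/
theorem neg_mul_logb_two_le {l : ℝ} (h0 : 0 ≤ l) (h1 : l ≤ 1) :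
    -(l * Real.logb 2 l) ≤
      2 * l - (4 * l - 1) / (4 * Real.log 2) - (4 * l - 1) ^ 2 / 16 := by
  have hlog2 : 0 < Real.log 2 := Real.log_pos one_lt_two
  rcases h0.eq_or_lt with rfl | hpos
  · have : 1 ≤ 1 / Real.log 2 := by
      rw [le_div_iff₀ hlog2]
      linarith [Real.log_two_lt_d9]
    have h : (4 * (0 : ℝ) - 1) / (4 * Real.log 2) = -(1 / Real.log 2) / 4 := by field_simp; ring
    rw [h]
    norm_num at this ⊢
    linarith
  · obtain ⟨u, hu, hul⟩ : ∃ u : ℝ, 0 < u ∧ u ^ 4 = 4 * l := by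
      refine ⟨√√(4 * l), by positivity, ?_⟩
      rw [show 4 = 2 * 2 from rfl, pow_mul, Real.sq_sqrt (by positivity),
        Real.sq_sqrt (by positivity)]
    have key := quadratic_le_pow_four_mul_log hu (by linarith)
    have h4 : Real.log 4 = 2 * Real.log 2 := by
      rw [show (4 : ℝ) = 2 ^ 2 by norm_num, Real.log_pow]
      norm_num
    rw [hul, Real.log_mul (by norm_num) hpos.ne', h4] at key
    rw [Real.logb, ← sub_nonneg]
    have : 2 * l - (4 * l - 1) / (4 * Real.log 2) - (4 * l - 1) ^ 2 / 16
        - -(l * (Real.log l / Real.log 2)) =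
        (4 * l * (2 * Real.log 2 + Real.log l) -
          (4 * l - 1 + Real.log 2 / 4 * (4 * l - 1) ^ 2)) / (4 * Real.log 2) := by
      field_simp
      ring
    rw [this]
    exact div_nonneg (sub_nonneg.2 key) (by positivity)

/-- The purity of a Hermitian matrix is the sum of the squares of its eigenvalues. -/
theorem Matrix.IsHermitian.trace_mul_self_eq_sum_eigenvalues_sq {n : Type*} [Fintype n]
    [DecidableEq n] {A : Matrix n n ℂ} (hA : A.IsHermitian) :
    (A * A).trace = ∑ i, ((hA.eigenvalues i ^ 2 : ℝ) : ℂ) := by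
  conv_lhs => rw [hA.spectral_theorem, ← map_mul, Unitary.conjStarAlgAut_apply,
    Matrix.trace_mul_comm, ← mul_assoc]
  simp [Matrix.diagonal_mul_diagonal, Matrix.trace_diagonal, pow_two]

/-- The purity of a Hermitian matrix is nonnegative. -/
theorem Matrix.IsHermitian.trace_mul_self_re_nonneg {n : Type*} [Fintype n]
    {A : Matrix n n ℂ} (hA : A.IsHermitian) : 0 ≤ (A * A).trace.re := by
  have h := (Matrix.posSemidef_conjTranspose_mul_self A).trace_nonneg
  rw [hA.eq] at h
  exact (Complex.le_def.1 h).1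

/-- Cauchy–Schwarz for the Hilbert–Schmidt inner product of Hermitian matrices. -/
theorem Matrix.IsHermitian.trace_mul_re_sq_le {n : Type*} [Fintype n]
    {A B : Matrix n n ℂ} (hA : A.IsHermitian) (hB : B.IsHermitian) :
    (A * B).trace.re ^ 2 ≤ (A * A).trace.re * (B * B).trace.re := by
  have h := discrim_le_zero (a := (B * B).trace.re) (b := 2 * (A * B).trace.re)
    (c := (A * A).trace.re) fun x => by
      have hx : (A + (x : ℂ) • B).IsHermitian := hA.add (by
        rw [Matrix.IsHermitian, Matrix.conjTranspose_smul, hB.eq]; simp)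
      have := hx.trace_mul_self_re_nonneg
      simp only [Matrix.add_mul, Matrix.mul_add, Matrix.trace_add, Matrix.smul_mul,
        Matrix.mul_smul, Matrix.trace_smul, smul_eq_mul, Matrix.trace_mul_comm B A,
        Complex.add_re, Complex.re_ofReal_mul] at this
      linarith
  rw [discrim] at h
  linarith

/-- Entropy of a two-qubit density matrix is bounded in terms of its purity. -/
theorem vnEntropy_le_sub_purity {τ : Matrix (Fin 2 × Fin 2) (Fin 2 × Fin 2) ℂ}
    (hτ : τ.IsHermitian) (hpos : τ.PosSemidef) (htr : τ.trace = 1) :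
    vnEntropy hτ ≤ 9 / 4 - (τ * τ).trace.re := by
  have hnonneg : ∀ i, 0 ≤ hτ.eigenvalues i := hpos.eigenvalues_nonneg
  have hsum : ∑ i, hτ.eigenvalues i = 1 := by
    have h : τ.trace = ∑ i, ((hτ.eigenvalues i : ℝ) : ℂ) := hτ.trace_eq_sum_eigenvalues
    rw [htr] at h
    exact_mod_cast h.symm
  have hle : ∀ i, hτ.eigenvalues i ≤ 1 := fun i =>
    hsum ▸ Finset.single_le_sum (fun j _ => hnonneg j) (Finset.mem_univ i)
  have hsq : (τ * τ).trace.re = ∑ i, hτ.eigenvalues i ^ 2 := by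
    rw [hτ.trace_mul_self_eq_sum_eigenvalues_sq, ← Complex.ofReal_sum, Complex.ofReal_re]
  rw [vnEntropy, ← Finset.sum_neg_distrib, hsq]
  refine (Finset.sum_le_sum fun i _ => neg_mul_logb_two_le (hnonneg i) (hle i)).trans_eq ?_
  have hterm : ∀ l : ℝ, 2 * l - (4 * l - 1) / (4 * Real.log 2) - (4 * l - 1) ^ 2 / 16 =
      (5 / 2 - 1 / Real.log 2) * l - l ^ 2 + (1 / (4 * Real.log 2) - 1 / 16) := fun l => by
    field_simp
    ring
  simp only [hterm, Finset.sum_add_distrib, Finset.sum_sub_distrib, ← Finset.mul_sum, hsum,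
    Finset.sum_const, Finset.card_univ, Fintype.card_prod, Fintype.card_fin, nsmul_eq_mul]
  push_cast
  field_simp
  ring

/-- For 2×2 density matrices `ρ, σ` and `τ = ½(ρ⊗σ + σ⊗ρ)`:
`S(τ) + Tr(ρσ) ≤ 5/2`, equivalently `S(τ) − 1 + Tr(ρσ) ≤ 3/2` (the sum-rate
bound for the unassisted two-user quantum binary adder channel). -/
theorem entropy_symmetrized_plus_overlap_le
    (ρ σ : Matrix (Fin 2) (Fin 2) ℂ)
    (hρ : ρ.PosSemidef) (hρ1 : ρ.trace = 1)
    (hσ : σ.PosSemidef) (hσ1 : σ.trace = 1)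
    (τ : Matrix (Fin 2 × Fin 2) (Fin 2 × Fin 2) ℂ)
    (hτdef : τ = (1/2 : ℂ) • (ρ ⊗ₖ σ + σ ⊗ₖ ρ))
    (hτ : τ.IsHermitian)
    (t : ℝ) (ht : (t : ℂ) = (ρ * σ).trace) :
    vnEntropy hτ + t ≤ 5 / 2 ∧ vnEntropy hτ - 1 + t ≤ 3 / 2 := by
  have htrace : τ.trace = 1 := by
    rw [hτdef, Matrix.trace_smul, Matrix.trace_add, Matrix.trace_kronecker,
      Matrix.trace_kronecker, hρ1, hσ1]
    norm_num
  have hpos : τ.PosSemidef := by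
    rw [hτdef]
    exact ((hρ.kronecker hσ).add (hσ.kronecker hρ)).smul (by norm_num [Complex.le_def])
  have hpurity : (τ * τ).trace =
      1 / 2 * ((ρ * ρ).trace * (σ * σ).trace + (ρ * σ).trace ^ 2) := by
    simp only [hτdef, Matrix.smul_mul, Matrix.mul_smul, Matrix.add_mul, Matrix.mul_add,
      ← Matrix.mul_kronecker_mul, Matrix.trace_smul, Matrix.trace_add, Matrix.trace_kronecker,
      smul_eq_mul, Matrix.trace_mul_comm σ ρ]
    ring
  have him : ∀ {A : Matrix (Fin 2) (Fin 2) ℂ}, A.IsHermitian → (A * A).trace.im = 0 := by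
    intro A hA
    rw [hA.trace_mul_self_eq_sum_eigenvalues_sq, ← Complex.ofReal_sum, Complex.ofReal_im]
  have hre : (τ * τ).trace.re =
      1 / 2 * ((ρ * ρ).trace.re * (σ * σ).trace.re + t ^ 2) := by
    rw [hpurity, ← ht]
    simp [him hρ.isHermitian, pow_two]
  have hcs := hρ.isHermitian.trace_mul_re_sq_le hσ.isHermitian
  rw [← ht, Complex.ofReal_re] at hcs
  have hS := vnEntropy_le_sub_purity hτ hpos htrace
  rw [hre] at hS
  have hbound : vnEntropy hτ + t ≤ 5 / 2 := by nlinarith [sq_nonneg (t - 1 / 2)]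
  exact ⟨hbound, by linarith⟩
end

section
/- For every real y with 0 ≤ y ≤ 1, one has 2·H₂((1−y)/2) + (y² − 1)/2 ≤ 3/2 − y²/2; in particular this expression is at most 3/2, with the maximum value 3/2 attained at y = 0. -/
open Set in
/-- The binary entropy in nats is at most its maximum `log 2` minus a quadratic deficit
(Pinsker's inequality against the fair coin). -/
theorem binEntropy_le_log_two_sub_sq {y : ℝ} (hy0 : 0 ≤ y) (hy1 : y ≤ 1) :
    Real.binEntropy ((1 - y) / 2) ≤ Real.log 2 - y ^ 2 / 2 := by
  have hanti : AntitoneOn (fun x : ℝ => Real.binEntropy ((1 - x) / 2) + x ^ 2 / 2) (Icc 0 1) := by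
    refine antitoneOn_of_hasDerivWithinAt_nonpos (convex_Icc 0 1) (by fun_prop)
      (f' := fun x => (Real.log (1 - (1 - x) / 2) - Real.log ((1 - x) / 2)) * (-1 / 2) + x)
      (fun x hx => ?_) (fun x hx => ?_)
    · rw [interior_Icc] at hx
      have hp : HasDerivAt (fun x : ℝ => (1 - x) / 2) (-1 / 2) x :=
        ((hasDerivAt_id x).const_sub 1).div_const 2
      have hq : HasDerivAt (fun x : ℝ => x ^ 2 / 2) x x := by
        simpa using (hasDerivAt_pow 2 x).div_const 2
      have hH := Real.hasDerivAt_binEntropy (p := (1 - x) / 2)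
        (by linarith [hx.2]) (by linarith [hx.1])
      exact ((hH.comp x hp).add hq).hasDerivWithinAt
    · rw [interior_Icc] at hx
      obtain ⟨h0, h1⟩ := hx
      have hs := Real.hasSum_log_sub_log_of_abs_lt_one (abs_lt.2 ⟨by linarith, h1⟩)
      have hle : 2 * x ≤ Real.log (1 + x) - Real.log (1 - x) := by
        simpa using le_hasSum hs 0 (fun k _ => by positivity)
      have e : 1 - (1 - x) / 2 = (1 + x) / 2 := by ring
      rw [e, Real.log_div (by linarith) two_ne_zero, Real.log_div (by linarith) two_ne_zero]
      linarith
  have h := hanti (left_mem_Icc.2 zero_le_one) ⟨hy0, hy1⟩ hy0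
  have h2 : Real.binEntropy ((1 - 0) / 2) = Real.log 2 := by
    rw [show ((1 - 0) / 2 : ℝ) = 2⁻¹ by norm_num, Real.binEntropy_two_inv]
  simp only [h2] at h
  linarith

theorem binEnt_eq_binEntropy_div_log_two (p : ℝ) :
    binEnt p = Real.binEntropy p / Real.log 2 := by
  simp only [binEnt, Real.binEntropy, Real.logb, Real.log_inv]
  ring

theorem binEnt_le_one_sub_sq {y : ℝ} (hy0 : 0 ≤ y) (hy1 : y ≤ 1) :
    binEnt ((1 - y) / 2) ≤ 1 - y ^ 2 / 2 := by
  rw [binEnt_eq_binEntropy_div_log_two, div_le_iff₀ (Real.log_pos one_lt_two)]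
  have hlog : Real.log 2 ≤ 1 := by linarith [Real.log_two_lt_d9]
  nlinarith [binEntropy_le_log_two_sub_sq hy0 hy1, sq_nonneg y]

/-- For `0 ≤ y ≤ 1`, `2·H₂((1−y)/2) + (y²−1)/2 ≤ 3/2 − y²/2`; in particular the
expression is at most `3/2`, with the maximum `3/2` attained at `y = 0`. -/
theorem rate_sum_bound_three_halves (y : ℝ) (hy0 : 0 ≤ y) (hy1 : y ≤ 1) :
    (2 * binEnt ((1 - y) / 2) + (y ^ 2 - 1) / 2 ≤ 3 / 2 - y ^ 2 / 2 ∧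
      2 * binEnt ((1 - y) / 2) + (y ^ 2 - 1) / 2 ≤ 3 / 2) ∧
    2 * binEnt ((1 - (0:ℝ)) / 2) + ((0:ℝ) ^ 2 - 1) / 2 = 3 / 2 := by
  have h := binEnt_le_one_sub_sq hy0 hy1
  refine ⟨⟨by linarith, by linarith [sq_nonneg y]⟩, ?_⟩
  rw [show ((1 - 0) / 2 : ℝ) = 2⁻¹ by norm_num, binEnt_eq_binEntropy_div_log_two,
    Real.binEntropy_two_inv, div_self (Real.log_pos one_lt_two).ne']
  norm_num
end

section
/- Let U_a, U_b be 2×2 unitary complex matrices, let ι : Fin 2 × Fin 2 × Fin 2 → ℂ be the GHZ state ι = (1/√2)(e₀⊗e₀⊗e₀ + e₁⊗e₁⊗e₁) (i.e. ι(i,j,k) = 1/√2 if i=j=k and 0 otherwise), let G = U_a ⊗ₖ U_b ⊗ₖ 1 acting on ℂ²⊗ℂ²⊗ℂ², and let F₁₂ = F ⊗ₖ 1 where F is the swap matrix on the first two factors. Then, with M = U_a† · U_b, the overlap ⟨G·ι, F₁₂·(G·ι)⟩ = ½(‖M 0 0‖² + ‖M 1 1‖²), where M i i denotes the (i,i) entry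 of M. -/
open Kronecker Matrix

/-- The swap (flip) matrix on `ℂ²⊗ℂ²`. -/
noncomputable def flipM : Matrix (Fin 2 × Fin 2) (Fin 2 × Fin 2) ℂ :=
  Matrix.of fun p q => if p.1 = q.2 ∧ p.2 = q.1 then 1 else 0

/-- The GHZ state on three qubits (first two factors grouped together). -/
noncomputable def ghz : (Fin 2 × Fin 2) × Fin 2 → ℂ :=
  fun x => if x.1.1 = x.1.2 ∧ x.1.2 = x.2 then ((Real.sqrt 2 : ℝ)⁻¹ : ℂ) else 0

/-- The matrix `flipM ⊗ₖ 1` exchanges the first two tensor factors. -/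
theorem flipM_kronecker_one_mulVec_apply (v : (Fin 2 × Fin 2) × Fin 2 → ℂ) (i j k : Fin 2) :
    ((flipM ⊗ₖ (1 : Matrix (Fin 2) (Fin 2) ℂ)).mulVec v) ((i, j), k) = v ((j, i), k) := by
  fin_cases i <;> fin_cases j <;> fin_cases k <;>
    simp [Matrix.mulVec, dotProduct, Fintype.sum_prod_type, flipM, Matrix.one_apply]

/-- Entries of a local operator on the first two qubits applied to the GHZ state. -/
theorem kronecker_one_mulVec_ghz_apply (A B : Matrix (Fin 2) (Fin 2) ℂ) (i j k : Fin 2) :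
    (((A ⊗ₖ B) ⊗ₖ (1 : Matrix (Fin 2) (Fin 2) ℂ)).mulVec ghz) ((i, j), k)
      = ((Real.sqrt 2 : ℝ)⁻¹ : ℂ) * (A i k * B j k) := by
  fin_cases k <;>
    simp [Matrix.mulVec, dotProduct, Fintype.sum_prod_type, ghz, Matrix.one_apply, mul_comm]

/-- With `G = U_a ⊗ U_b ⊗ 1` acting on the GHZ state `ι`, and `F₁₂` the swap of
the first two qubits, the overlap `⟨Gι, F₁₂ Gι⟩` equals
`½(‖M₀₀‖² + ‖M₁₁‖²)` where `M = U_a† U_b`. -/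
theorem ghz_flip_overlap
    (Ua Ub : Matrix (Fin 2) (Fin 2) ℂ)
    (hUa : Uaᴴ * Ua = 1) (hUb : Ubᴴ * Ub = 1)
    (G : Matrix ((Fin 2 × Fin 2) × Fin 2) ((Fin 2 × Fin 2) × Fin 2) ℂ)
    (hG : G = (Ua ⊗ₖ Ub) ⊗ₖ (1 : Matrix (Fin 2) (Fin 2) ℂ))
    (F₁₂ : Matrix ((Fin 2 × Fin 2) × Fin 2) ((Fin 2 × Fin 2) × Fin 2) ℂ)
    (hF : F₁₂ = flipM ⊗ₖ (1 : Matrix (Fin 2) (Fin 2) ℂ))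
    (M : Matrix (Fin 2) (Fin 2) ℂ) (hM : M = Uaᴴ * Ub) :
    innerC (G.mulVec ghz) (F₁₂.mulVec (G.mulVec ghz))
      = (((1/2) * (‖M 0 0‖ ^ 2 + ‖M 1 1‖ ^ 2) : ℝ) : ℂ) := by
  subst hG hF hM
  have hs : ((Real.sqrt 2 : ℝ)⁻¹ : ℂ) * ((Real.sqrt 2 : ℝ)⁻¹ : ℂ) = 1 / 2 := by
    rw [← mul_inv, ← Complex.ofReal_mul, Real.mul_self_sqrt (by norm_num)]
    norm_num
  have hn (z : ℂ) : ((‖z‖ : ℂ)) ^ 2 = star z * z := (Complex.conj_mul' z).symm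
  push_cast
  rw [hn, hn, ← hs]
  simp only [innerC, Fintype.sum_prod_type, flipM_kronecker_one_mulVec_apply,
    kronecker_one_mulVec_ghz_apply, Fin.sum_univ_two, Matrix.mul_apply,
    Matrix.conjTranspose_apply, map_mul, map_add, map_inv₀,
    Complex.star_def, Complex.conj_ofReal, Complex.conj_conj]
  ring
end

section
/- Let u : (Fin 2 × Fin 2) × (Fin 2 × Fin 2) → ℂ be a unit vector (a pure state on ℂ⁴⊗ℂ⁴) that is maximally entangled, i.e. its reduced state on the first factor is maximally mixed: for all a, b ∈ Fin 2 × Fin 2, Σ_c u(a,c)·conj(u(b,c)) = 1/4 if a = b and 0 otherwise. Let F be the swap matrix on ℂ²⊗ℂ² and let ω = ½(|u⟩⟨u| + (F ⊗ₖ 1)·|u⟩⟨u|·(F ⊗ₖ 1)). Then the von Neumann entropy (in bits) of ω equals H₂(1/4) = 2 − (3/4)·log₂ 3. -/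
open Kronecker

/-- The von Neumann entropy depends only on the roots of the characteristic polynomial. -/
lemma vnEntropy_eq_neg_sum_roots_charpoly {m : Type*} [Fintype m] [DecidableEq m]
    {ρ : Matrix m m ℂ} (hρ : ρ.IsHermitian) :
    vnEntropy hρ = -(ρ.charpoly.roots.map fun z => z.re * Real.logb 2 z.re).sum := by
  simp [vnEntropy, hρ.roots_charpoly_eq_eigenvalues, Multiset.map_map]

/-- The nonzero part of the spectrum of `½(|u⟩⟨u| + |v⟩⟨v|)` is that of half the Gram matrix. -/
lemma charpoly_half_smul_outer_add_outer {α : Type*} [Fintype α] [DecidableEq α]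
    (hα : 2 ≤ Fintype.card α) (u v : α → ℂ) :
    ((1 / 2 : ℂ) • (outer u + outer v)).charpoly =
      Polynomial.X ^ (Fintype.card α - 2) *
        ((1 / 2 : ℂ) • !![innerC u u, innerC u v; innerC v u, innerC v v]).charpoly := by
  have hprod : (1 / 2 : ℂ) • (outer u + outer v) =
      (Matrix.of fun i j => ![u i, v i] j) *
        ((1 / 2 : ℂ) • Matrix.of fun j i => ![star (u i), star (v i)] j) := by
    ext i j
    simp [outer, Matrix.mul_apply]
    ring
  have hgram : ((1 / 2 : ℂ) • Matrix.of fun j i => ![star (u i), star (v i)] j) *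
      (Matrix.of fun i j => ![u i, v i] j) =
      (1 / 2 : ℂ) • !![innerC u u, innerC u v; innerC v u, innerC v v] := by
    rw [Matrix.smul_mul]
    congr 1
    ext i j
    fin_cases i <;> fin_cases j <;> simp [innerC, Matrix.mul_apply]
  rw [hprod, Matrix.charpoly_mul_comm_of_le _ _ (by simpa using hα), hgram, Fintype.card_fin]

/-- Left multiplication by `F ⊗ 1` swaps the two qubits of the first factor. -/
lemma flipM_kronecker_one_mulVec (u : (Fin 2 × Fin 2) × (Fin 2 × Fin 2) → ℂ) :
    Matrix.mulVec (flipM ⊗ₖ (1 : Matrix (Fin 2 × Fin 2) (Fin 2 × Fin 2) ℂ)) u =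
      fun p => u (p.1.swap, p.2) := by
  ext ⟨⟨a, b⟩, c⟩
  simp [Matrix.mulVec, dotProduct, flipM, Matrix.one_apply, Fintype.sum_prod_type, ite_and]

lemma flipM_kronecker_one_isHermitian :
    (flipM ⊗ₖ (1 : Matrix (Fin 2 × Fin 2) (Fin 2 × Fin 2) ℂ)).IsHermitian := by
  have hF : flipM.IsHermitian := by
    ext ⟨a, b⟩ ⟨c, d⟩
    simp only [flipM, Matrix.conjTranspose_apply, Matrix.of_apply]
    split_ifs <;> simp_all
  rw [Matrix.IsHermitian, Matrix.conjTranspose_kronecker, hF.eq, Matrix.conjTranspose_one]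

lemma mul_outer_mul_conjTranspose {α : Type*} [Fintype α] (M : Matrix α α ℂ) (u : α → ℂ) :
    M * outer u * M.conjTranspose = outer (M.mulVec u) := by
  have h : ∀ w : α → ℂ, outer w = Matrix.vecMulVec w (star w) := fun w => rfl
  rw [h, h, Matrix.mul_vecMulVec, Matrix.vecMulVec_mul, Matrix.star_mulVec]

lemma binEnt_one_quarter : binEnt (1 / 4) = 2 - (3 / 4) * Real.logb 2 3 := by
  have h4 : Real.logb 2 4 = 2 := by
    rw [show (4 : ℝ) = 2 ^ (2 : ℝ) by norm_num]
    exact Real.logb_rpow (by norm_num) (by norm_num)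
  rw [binEnt, show (1 : ℝ) - 1 / 4 = 3 / 4 by norm_num, Real.logb_div (by norm_num) (by norm_num),
    Real.logb_div (by norm_num) (by norm_num), h4, Real.logb_one]
  ring

/-- For a maximally entangled pure state `u` on `ℂ⁴⊗ℂ⁴`, the output of the
two-user adder channel applied to the first two qubits,
`ω = ½(|u⟩⟨u| + (F⊗1)|u⟩⟨u|(F⊗1))`, has von Neumann entropy
`H₂(1/4) = 2 − (3/4)·log₂ 3`. -/
theorem entropy_of_flipped_maximally_entangled
    (u : (Fin 2 × Fin 2) × (Fin 2 × Fin 2) → ℂ)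
    (hu : innerC u u = 1)
    (hmax : ∀ a b : Fin 2 × Fin 2,
      (∑ c : Fin 2 × Fin 2, u (a, c) * star (u (b, c)))
        = if a = b then (1/4 : ℂ) else 0)
    (ω : Matrix ((Fin 2 × Fin 2) × (Fin 2 × Fin 2))
                ((Fin 2 × Fin 2) × (Fin 2 × Fin 2)) ℂ)
    (hωdef : ω = (1/2 : ℂ) •
      (outer u +
        (flipM ⊗ₖ (1 : Matrix (Fin 2 × Fin 2) (Fin 2 × Fin 2) ℂ)) * outer u *
          (flipM ⊗ₖ (1 : Matrix (Fin 2 × Fin 2) (Fin 2 × Fin 2) ℂ))))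
    (hω : ω.IsHermitian) :
    vnEntropy hω = binEnt (1/4) ∧
      binEnt (1/4) = 2 - (3/4) * Real.logb 2 3 := by
  refine ⟨?_, binEnt_one_quarter⟩
  set v : (Fin 2 × Fin 2) × (Fin 2 × Fin 2) → ℂ := fun p => u (p.1.swap, p.2) with hv
  have hω' : ω = (1 / 2 : ℂ) • (outer u + outer v) := by
    have h := mul_outer_mul_conjTranspose
      (flipM ⊗ₖ (1 : Matrix (Fin 2 × Fin 2) (Fin 2 × Fin 2) ℂ)) u
    rw [flipM_kronecker_one_isHermitian.eq, flipM_kronecker_one_mulVec] at h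
    rw [hωdef, h]
  have hvv : innerC v v = 1 := by
    rw [← hu]
    exact Equiv.sum_comp ((Equiv.prodComm (Fin 2) (Fin 2)).prodCongr (Equiv.refl _))
      fun p => star (u p) * u p
  have huv : innerC u v = 1 / 2 := by
    have h : innerC u v = ∑ a : Fin 2 × Fin 2, ∑ c, u (a.swap, c) * star (u (a, c)) := by
      simp only [innerC, hv, Fintype.sum_prod_type (α₁ := Fin 2 × Fin 2), mul_comm]
    rw [h]
    simp_rw [hmax]
    simp [Fintype.sum_prod_type]
    norm_num
  have hvu : innerC v u = 1 / 2 := by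
    have h : innerC v u = star (innerC u v) := by
      simp [innerC, mul_comm]
    rw [h, huv]
    simp
  have hchar : ω.charpoly = Polynomial.X ^ 14 *
      ((Polynomial.X - Polynomial.C (3 / 4)) * (Polynomial.X - Polynomial.C (1 / 4))) := by
    rw [hω', charpoly_half_smul_outer_add_outer (by simp), hu, huv, hvu, hvv,
      Matrix.charpoly_fin_two]
    congr 1
    have htrace : ((1 / 2 : ℂ) • !![(1 : ℂ), 1 / 2; 1 / 2, 1]).trace = 3 / 4 + 1 / 4 := by
      norm_num [Matrix.trace_fin_two]
    have hdet : ((1 / 2 : ℂ) • !![(1 : ℂ), 1 / 2; 1 / 2, 1]).det = 3 / 4 * (1 / 4) := by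
      norm_num [Matrix.det_fin_two]
    rw [htrace, hdet, Polynomial.C_add, Polynomial.C_mul]
    ring
  have hroots : ω.charpoly.roots = 14 • {0} + ({3 / 4} + {1 / 4}) := by
    have hne : (Polynomial.X - Polynomial.C (3 / 4 : ℂ)) *
        (Polynomial.X - Polynomial.C (1 / 4)) ≠ 0 :=
      mul_ne_zero (Polynomial.X_sub_C_ne_zero _) (Polynomial.X_sub_C_ne_zero _)
    rw [hchar, Polynomial.roots_mul (mul_ne_zero (pow_ne_zero _ Polynomial.X_ne_zero) hne),
      Polynomial.roots_mul hne, Polynomial.roots_X_pow, Polynomial.roots_X_sub_C,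
      Polynomial.roots_X_sub_C]
  have hre3 : (3 / 4 : ℂ).re = 3 / 4 := by norm_num
  have hre1 : (1 / 4 : ℂ).re = 1 / 4 := by norm_num
  rw [vnEntropy_eq_neg_sum_roots_charpoly, hroots, Multiset.map_add, Multiset.map_add,
    Multiset.map_nsmul, Multiset.sum_add, Multiset.sum_add, Multiset.sum_nsmul,
    Multiset.map_singleton, Multiset.map_singleton, Multiset.map_singleton,
    Multiset.sum_singleton, Multiset.sum_singleton, Multiset.sum_singleton, hre3, hre1,
    Complex.zero_re, binEnt, show (1 : ℝ) - 1 / 4 = 3 / 4 by norm_num]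
  ring
end
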